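/- arXiv:math/0409390 — 3 statements merged into one kernel-verified Lean document; each statement's English description precedes it below -/
import Mathlib

section
/- Let f : ℝⁿ → ℝⁿ be ℝ-analytic with f(0) = 0 and Df(0) Hurwitz, let V be the analytic solution of ⟨∇V(x), f(x)⟩ = −‖x‖², V(0) = 0, on a neighborhood of 0, and let V_p be its Taylor polynomial of degree p ≥ 2 at 0. Then there exists r_p > 0 such that for all x with 0 < ‖x‖ ≤ r_p: (1) V_p(x) > 0 and (2) ⟨∇V_p(x), f(x)⟩ < 0; in fact ⟨∇V_p(x), f(x)⟩ ≤ −½‖x‖². -/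
noncomputable section

open scoped RealInnerProductSpace

/-- All eigenvalues of `A` (as a complex matrix) have negative real part. -/
def IsHurwitz {n : ℕ} (A : Matrix (Fin n) (Fin n) ℝ) : Prop :=
  ∀ μ ∈ spectrum ℂ (A.map (algebraMap ℝ ℂ)), μ.re < 0

/-- Action of a matrix on a vector of `EuclideanSpace ℝ (Fin n)`. -/
def mulVecE {n : ℕ} (A : Matrix (Fin n) (Fin n) ℝ) (x : EuclideanSpace ℝ (Fin n)) :
    EuclideanSpace ℝ (Fin n) :=
  (WithLp.equiv 2 (Fin n → ℝ)).symm (A.mulVec ((WithLp.equiv 2 (Fin n → ℝ)) x))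

/-- The Taylor polynomial of degree `p` of `V` at `0`. -/
def taylorPoly {n : ℕ} (V : EuclideanSpace ℝ (Fin n) → ℝ) (p : ℕ)
    (x : EuclideanSpace ℝ (Fin n)) : ℝ :=
  ∑ i ∈ Finset.range (p + 1), ((i.factorial : ℝ))⁻¹ * iteratedFDeriv ℝ i V 0 (fun _ => x)

theorem eig_of_spec {n : ℕ} (M : Matrix (Fin n) (Fin n) ℂ) (μ : ℂ) :
    μ ∈ spectrum ℂ M ↔ ∃ v, v ≠ 0 ∧ M.mulVec v = μ • v := by
  rw [spectrum.mem_iff, Matrix.isUnit_iff_isUnit_det, isUnit_iff_ne_zero, not_not,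
    ← Matrix.exists_mulVec_eq_zero_iff]
  refine exists_congr fun v => and_congr_right fun _ => ?_
  rw [Matrix.sub_mulVec, sub_eq_zero, Algebra.algebraMap_eq_smul_one, Matrix.smul_mulVec,
    Matrix.one_mulVec]
  exact eq_comm

theorem hurwitz_inj {n : ℕ} {A : Matrix (Fin n) (Fin n) ℝ} (hA : IsHurwitz A) (c : ℝ)
    (hc : 0 ≤ c) (x : Fin n → ℝ) (h : A.mulVec x = c • x) : x = 0 := by
  by_contra hx
  have : (c : ℂ) ∈ spectrum ℂ (A.map (algebraMap ℝ ℂ)) := by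
    rw [eig_of_spec]
    refine ⟨fun i => (x i : ℂ), fun h0 => hx ?_, ?_⟩
    · ext i
      have := congrFun h0 i
      simpa using this
    · ext i
      have := congrFun h i
      simp only [Matrix.mulVec, dotProduct, Pi.smul_apply, smul_eq_mul] at this
      simp only [Matrix.mulVec, dotProduct, Pi.smul_apply, smul_eq_mul, Matrix.map_apply]
      rw [← Complex.ofReal_mul, ← this]
      simp
  have := hA _ this
  simp at this
  linarith

section
attribute [local instance] Matrix.linftyOpNormedRing Matrix.linftyOpNormedAlgebra

theorem exists_pow_norm_lt_one {n : ℕ} (hn : n ≠ 0) (M : Matrix (Fin n) (Fin n) ℂ)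
    (h : ∀ μ ∈ spectrum ℂ M, ‖μ‖ < 1) : ∃ k : ℕ, ∀ i j,
    Filter.Tendsto (fun m : ℕ => ((M ^ k) ^ m) i j) Filter.atTop (nhds 0) := by
  have : NeZero n := ⟨hn⟩
  have h1 : spectralRadius ℂ M < ((1 : NNReal) : ENNReal) :=
    spectrum.spectralRadius_lt_of_forall_lt M (fun μ hμ => by exact_mod_cast h μ hμ)
  have h2 := spectrum.pow_nnnorm_pow_one_div_tendsto_nhds_spectralRadius M
  have h3 := h2.eventually (gt_mem_nhds h1)
  obtain ⟨k, hk, hk0⟩ := (h3.and (Filter.eventually_gt_atTop 0)).exists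
  have hlt : ‖M ^ k‖ < 1 := ?_
  · have ht := tendsto_pow_atTop_nhds_zero_of_norm_lt_one hlt
    refine ⟨k, fun i j => ?_⟩
    have hc : Continuous (fun M : Matrix (Fin n) (Fin n) ℂ => M i j) :=
      (continuous_apply j).comp (continuous_apply i)
    exact (hc.tendsto 0).comp ht
  by_contra hcon
  push Not at hcon
  refine absurd hk (not_lt.mpr ?_)
  have : (1 : ENNReal) ≤ (‖M ^ k‖₊ : ENNReal) := by exact_mod_cast hcon
  exact ENNReal.one_le_rpow this (by positivity)
end

theorem mob {l : ℂ} {m : ℂ} (h : (1 + l) * m = l - 1) (hm : m.re < 0) : ‖l‖ < 1 := by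
  have h1 := congrArg Complex.re h
  have h2 := congrArg Complex.im h
  simp at h1 h2
  have : Complex.normSq l < 1 := by
    rw [Complex.normSq_apply]
    have hne : 0 < (1 + l.re)^2 + l.im^2 := by
      by_contra hh
      have ha : (1 + l.re) = 0 := by nlinarith [sq_nonneg (1 + l.re), sq_nonneg l.im]
      have hb : l.im = 0 := by nlinarith [sq_nonneg (1 + l.re), sq_nonneg l.im]
      rw [ha, hb] at h1
      linarith
    have key : ((1 + l.re)^2 + l.im^2) * m.re = l.re*l.re + l.im*l.im - 1 := by
      linear_combination (1 + l.re) * h1 + l.im * h2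
    nlinarith
  rw [← Complex.sq_norm] at this
  nlinarith [norm_nonneg l]

theorem lyap {n : ℕ} {A : Matrix (Fin n) (Fin n) ℝ} (hA : IsHurwitz A)
    (q N : (Fin n → ℝ) → ℝ) (hq : Continuous q) (q0 : q 0 = 0) (hN : ∀ y, y ≠ 0 → 0 < N y)
    (hN0 : ∀ y, 0 ≤ N y)
    (h : ∀ y, q (y - A.mulVec y) = q (y + A.mulVec y) + N y) (x : Fin n → ℝ) (hx : x ≠ 0) :
    0 < q x := by
  have hn : n ≠ 0 := by
    rintro rfl
    exact hx (Subsingleton.elim _ _)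
  have hdet : IsUnit (1 - A).det := by
    rw [isUnit_iff_ne_zero]
    intro h0
    obtain ⟨v, hv, hv0⟩ := Matrix.exists_mulVec_eq_zero_iff.mpr h0
    rw [Matrix.sub_mulVec, Matrix.one_mulVec, sub_eq_zero] at hv0
    exact hv (hurwitz_inj hA 1 zero_le_one v (by rw [one_smul]; exact hv0.symm))
  set D := (1 - A)⁻¹ with hD
  have hD1 : (1 - A) * D = 1 := Matrix.mul_nonsing_inv _ hdet
  have hD2 : D * (1 - A) = 1 := Matrix.nonsing_inv_mul _ hdet
  set C := (1 + A) * D with hC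
  let φ : Matrix (Fin n) (Fin n) ℝ →+* Matrix (Fin n) (Fin n) ℂ := (algebraMap ℝ ℂ).mapMatrix
  have hφA : φ A = A.map (algebraMap ℝ ℂ) := rfl
  have hsp : ∀ μ ∈ spectrum ℂ (φ C), ‖μ‖ < 1 := by
    intro l hl
    rw [eig_of_spec] at hl
    obtain ⟨v, hv, hl⟩ := hl
    have e1 : (1 - φ A) * φ D = 1 := by rw [← map_one φ, ← map_sub, ← map_mul, hD1]
    set y := (φ D).mulVec v with hy
    have e2 : y - (φ A).mulVec y = v := by
      have : (1 - φ A).mulVec y = v := by rw [hy, Matrix.mulVec_mulVec, e1, Matrix.one_mulVec]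
      rwa [Matrix.sub_mulVec, Matrix.one_mulVec] at this
    have e3 : y + (φ A).mulVec y = l • v := by
      rw [← hl, hC, map_mul, map_add, map_one, ← Matrix.mulVec_mulVec, Matrix.add_mulVec,
        Matrix.one_mulVec]
    have hy0 : y ≠ 0 := by
      intro h0
      rw [h0] at e2
      simp at e2
      exact hv e2.symm
    rw [← e2] at e3
    have e4 : (1 + l) • (φ A).mulVec y = (l - 1) • y := by
      ext i
      have := congrFun e3 i
      simp at this ⊢
      linear_combination this
    have hl1 : 1 + l ≠ 0 := by
      intro h0
      rw [h0, zero_smul] at e4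
      have hl' : l = -1 := by linear_combination h0
      rw [hl'] at e4
      have := (smul_eq_zero.mp e4.symm).resolve_left (by norm_num)
      exact hy0 this
    refine mob (m := (1 + l)⁻¹ * (l - 1)) (by field_simp) (hA _ ?_)
    rw [eig_of_spec]
    refine ⟨y, hy0, ?_⟩
    rw [mul_smul, ← e4, smul_smul, inv_mul_cancel₀ hl1, one_smul, hφA]
  obtain ⟨k, hk⟩ := exists_pow_norm_lt_one hn _ hsp
  have step : ∀ z, q z = q (C.mulVec z) + N (D.mulVec z) := by
    intro z
    have := h (D.mulVec z)
    have e2 : D.mulVec z - A.mulVec (D.mulVec z) = z := by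
      have : (1 - A).mulVec (D.mulVec z) = z := by
        rw [Matrix.mulVec_mulVec, hD1, Matrix.one_mulVec]
      rwa [Matrix.sub_mulVec, Matrix.one_mulVec] at this
    have e3 : D.mulVec z + A.mulVec (D.mulVec z) = C.mulVec z := by
      rw [hC, ← Matrix.mulVec_mulVec, Matrix.add_mulVec, Matrix.one_mulVec]
    rwa [e2, e3] at this
  have hle : ∀ (j : ℕ) (z), q ((C ^ j).mulVec z) ≤ q z := by
    intro j
    induction j with
    | zero => intro z; simp
    | succ j ih =>
      intro z
      rw [pow_succ, ← Matrix.mulVec_mulVec]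
      refine (ih _).trans ?_
      have := step z
      have := hN0 (D.mulVec z)
      linarith
  have hnonneg : ∀ z, 0 ≤ q z := by
    intro z
    have ht : Filter.Tendsto (fun m : ℕ => ((C ^ k) ^ m).mulVec z) Filter.atTop (nhds 0) := by
      have hC0 : Filter.Tendsto (fun m : ℕ => ((C ^ k) ^ m)) Filter.atTop (nhds 0) := by
        refine tendsto_pi_nhds.mpr fun i => tendsto_pi_nhds.mpr fun j => ?_
        have hk := (Complex.continuous_re.tendsto _).comp (hk i j)
        refine Filter.Tendsto.congr ?_ hk
        intro m
        simp only [Function.comp, ← map_pow]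
        rfl
      have hc : Continuous (fun M : Matrix (Fin n) (Fin n) ℝ => M.mulVec z) := by fun_prop
      have := (hc.tendsto 0).comp hC0
      simpa [Function.comp_def] using this
    have := (hq.tendsto 0).comp ht
    rw [q0] at this
    refine le_of_tendsto this (Filter.Eventually.of_forall fun m => ?_)
    simp only [Function.comp, ← pow_mul]
    exact hle _ _
  rw [step x]
  have : D.mulVec x ≠ 0 := by
    intro h0
    apply hx
    have : (1 - A).mulVec (D.mulVec x) = x := by
      rw [Matrix.mulVec_mulVec, hD1, Matrix.one_mulVec]
    rw [← this, h0, Matrix.mulVec_zero]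
  linarith [hN _ this, hnonneg (C.mulVec x)]

theorem mono_bound {E : Type*} [NormedAddCommGroup E] [NormedSpace ℝ E] (j : ℕ)
    (M : E [×(3 + j)]→L[ℝ] ℝ) :
    ∃ (R' : E → E →L[ℝ] ℝ) (K : ℝ), ∀ x, HasFDerivAt (fun x => M (fun _ => x)) (R' x) x ∧
      (‖x‖ ≤ 1 → ‖R' x‖ ≤ K * ‖x‖ ^ 2 ∧ |M (fun _ => x)| ≤ K * ‖x‖ ^ 3) := by
  refine ⟨fun x => (M.linearDeriv (fun _ => x)).comp
    (ContinuousLinearMap.pi fun _ => ContinuousLinearMap.id ℝ E), ‖M‖ * (3 + j), fun x => ⟨?_, ?_⟩⟩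
  · have h1 : HasFDerivAt (fun x : E => (fun _ : Fin (3 + j) => x))
      (ContinuousLinearMap.pi fun _ => ContinuousLinearMap.id ℝ E) x :=
      (ContinuousLinearMap.pi fun _ : Fin (3 + j) => ContinuousLinearMap.id ℝ E).hasFDerivAt
    exact (M.hasFDerivAt (fun _ => x)).comp x h1
  · intro hx
    constructor
    · refine ContinuousLinearMap.opNorm_le_bound _ (by positivity) fun h => ?_
      simp only [ContinuousLinearMap.comp_apply, ContinuousMultilinearMap.linearDeriv_apply]
      refine (norm_sum_le _ _).trans ?_
      have : ∀ i : Fin (3 + j), ‖M (Function.update (fun _ => x) i h)‖ ≤ ‖M‖ * (‖h‖ * ‖x‖ ^ 2) := by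
        intro i
        refine (M.le_opNorm _).trans ?_
        gcongr
        rw [← Finset.mul_prod_erase _ _ (Finset.mem_univ i)]
        simp only [Function.update_self]
        gcongr
        rw [Finset.prod_congr rfl (g := fun _ => ‖x‖) (fun k hk => by
          rw [Function.update_of_ne (Finset.ne_of_mem_erase hk)])]
        rw [Finset.prod_const, Finset.card_erase_of_mem (Finset.mem_univ i)]
        simp only [Finset.card_univ, Fintype.card_fin]
        exact pow_le_pow_of_le_one (norm_nonneg _) hx (by omega)
      refine (Finset.sum_le_sum fun i _ => this i).trans (le_of_eq ?_)
      simp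
      ring
    · have h1 := M.le_opNorm (fun _ => x)
      simp only [Finset.prod_const, Finset.card_univ, Fintype.card_fin] at h1
      refine h1.trans ?_
      have h2 : ‖x‖ ^ (3 + j) ≤ ‖x‖ ^ 3 := pow_le_pow_of_le_one (norm_nonneg _) hx (by omega)
      have h3 : (1 : ℝ) ≤ 3 + j := by have : (0:ℝ) ≤ j := by positivity
                                      linarith
      calc ‖M‖ * ‖x‖ ^ (3 + j) ≤ ‖M‖ * 1 * ‖x‖ ^ 3 := by rw [mul_one]; gcongr
        _ ≤ _ := by gcongr

theorem taylor_decomp {n : ℕ} (V : EuclideanSpace ℝ (Fin n) → ℝ) (m : ℕ) :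
    ∃ (R : EuclideanSpace ℝ (Fin n) → ℝ)
      (R' : EuclideanSpace ℝ (Fin n) → EuclideanSpace ℝ (Fin n) →L[ℝ] ℝ) (K : ℝ),
      (∀ x, taylorPoly V (2 + m) x =
        V 0 + fderiv ℝ V 0 x + (1/2) * fderiv ℝ (fderiv ℝ V) 0 x x + R x) ∧
      ∀ x, HasFDerivAt R (R' x) x ∧
        (‖x‖ ≤ 1 → ‖R' x‖ ≤ K * ‖x‖ ^ 2 ∧ |R x| ≤ K * ‖x‖ ^ 3) := by
  choose R' K h using fun j => mono_bound j (iteratedFDeriv ℝ (3 + j) V 0)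
  refine ⟨fun x => ∑ j ∈ Finset.range m, (((3 + j).factorial : ℝ))⁻¹ *
      iteratedFDeriv ℝ (3 + j) V 0 (fun _ => x),
    fun x => ∑ j ∈ Finset.range m, (((3 + j).factorial : ℝ))⁻¹ • R' j x,
    ∑ j ∈ Finset.range m, (((3 + j).factorial : ℝ))⁻¹ * K j, fun x => ?_, fun x => ⟨?_, ?_⟩⟩
  · unfold taylorPoly
    rw [show 2 + m + 1 = 3 + m by ring, Finset.sum_range_add]
    congr 1
    simp only [Finset.sum_range_succ, Finset.sum_range_zero]
    rw [iteratedFDeriv_zero_apply, iteratedFDeriv_one_apply, iteratedFDeriv_two_apply]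
    norm_num [Nat.factorial]
  · apply HasFDerivAt.fun_sum
    intro j _
    exact ((h j x).1).const_mul _
  · intro hx
    constructor
    · refine (norm_sum_le _ _).trans ?_
      rw [Finset.sum_mul]
      refine Finset.sum_le_sum fun j _ => ?_
      rw [norm_smul, Real.norm_of_nonneg (by positivity), mul_assoc]
      have := ((h j x).2 hx).1
      gcongr
    · refine (Finset.abs_sum_le_sum_abs _ _).trans ?_
      rw [Finset.sum_mul]
      refine Finset.sum_le_sum fun j _ => ?_
      rw [abs_mul, abs_of_nonneg (by positivity), mul_assoc]
      have := ((h j x).2 hx).2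
      gcongr

open Asymptotics Topology in
theorem second_order {E : Type*} [NormedAddCommGroup E] [NormedSpace ℝ E]
    (G : E → E →L[ℝ] ℝ) (B : E →L[ℝ] E →L[ℝ] ℝ) (f : E → E) (A : E →L[ℝ] E)
    (hG0 : G 0 = 0) (hG : HasFDerivAt G B 0) (hf0 : f 0 = 0) (hf : HasFDerivAt f A 0) :
    (fun x => G x (f x) - B x (A x)) =o[𝓝 0] (fun x => ‖x‖ ^ 2) := by
  have h1 : (fun x => G x - B x) =o[𝓝 0] (fun x => x) := by
    simpa [hG0] using hG.isLittleO
  have h2 : (fun x => f x - A x) =o[𝓝 0] (fun x => x) := by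
    simpa [hf0] using hf.isLittleO
  have h3 : f =O[𝓝 0] (fun x => x) := by
    simpa [hf0] using hf.isBigO_sub
  have h4 : (fun x => (G x - B x) (f x)) =o[𝓝 0] (fun x => ‖x‖ ^ 2) := by
    have : (fun x => ‖G x - B x‖ * ‖f x‖) =o[𝓝 0] (fun x => ‖x‖ * ‖x‖) :=
      h1.norm_norm.mul_isBigO h3.norm_norm
    simp only [← sq] at this
    refine IsBigO.trans_isLittleO (IsBigO.of_bound 1 (Filter.Eventually.of_forall fun x => ?_)) this
    rw [one_mul, norm_mul, norm_norm, norm_norm]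
    exact ContinuousLinearMap.le_opNorm _ _
  have h5 : (fun x => B x (f x - A x)) =o[𝓝 0] (fun x => ‖x‖ ^ 2) := by
    have : (fun x => ‖B x‖ * ‖f x - A x‖) =o[𝓝 0] (fun x => ‖x‖ * ‖x‖) :=
      (B.isBigO_id _).norm_norm.mul_isLittleO h2.norm_norm
    simp only [← sq] at this
    refine IsBigO.trans_isLittleO (IsBigO.of_bound 1 (Filter.Eventually.of_forall fun x => ?_)) this
    rw [one_mul, norm_mul, norm_norm, norm_norm]
    exact ContinuousLinearMap.le_opNorm _ _
  refine (h4.add h5).congr_left fun x => ?_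
  simp

/-- a homogeneous degree 2 function that is o(‖x‖²) vanishes -/
theorem homog_zero {E : Type*} [NormedAddCommGroup E] [NormedSpace ℝ E] (g : E → ℝ)
    (hg : ∀ (t : ℝ) x, g (t • x) = t ^ 2 * g x)
    (h : g =o[nhds 0] (fun x => ‖x‖ ^ 2)) (x : E) : g x = 0 := by
  have hx : Filter.Tendsto (fun t : ℝ => t • x) (nhdsWithin 0 {0}ᶜ) (nhds 0) := by
    have : Continuous (fun t : ℝ => t • x) := by fun_prop
    have := (this.tendsto 0).mono_left (nhdsWithin_le_nhds (s := {0}ᶜ))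
    simpa using this
  have h1 := h.comp_tendsto hx
  by_contra hne
  have hpos : 0 < |g x| := abs_pos.mpr hne
  have h2 := h1.def (c := |g x| / (‖x‖ ^ 2 + 1) / 2) (by positivity)
  obtain ⟨t, ht, ht0⟩ := (h2.and self_mem_nhdsWithin).exists
  simp only [Function.comp, hg, norm_smul, Real.norm_eq_abs, abs_mul, abs_pow, mul_pow,
    abs_abs, abs_norm] at ht
  have ht0 : 0 < |t| ^ 2 := by
    have : t ≠ 0 := ht0
    positivity
  have h3 : |g x| ≤ |g x| / (‖x‖ ^ 2 + 1) / 2 * ‖x‖ ^ 2 := by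
    refine le_of_mul_le_mul_left ?_ ht0
    linarith
  have h4 : |g x| / (‖x‖ ^ 2 + 1) * ‖x‖ ^ 2 ≤ |g x| := by
    rw [div_mul_eq_mul_div, div_le_iff₀ (by positivity)]
    nlinarith
  linarith

theorem taylor_polys_are_Lyapunov_functions {n : ℕ}
    (f : EuclideanSpace ℝ (Fin n) → EuclideanSpace ℝ (Fin n))
    -- f is ℝ-analytic, f(0) = 0
    (hf : ∀ x, AnalyticAt ℝ f x) (hf0 : f 0 = 0)
    -- the Jacobian of f at 0 is the Hurwitz matrix A
    (A : Matrix (Fin n) (Fin n) ℝ)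
    (A' : EuclideanSpace ℝ (Fin n) →L[ℝ] EuclideanSpace ℝ (Fin n))
    (hA' : ∀ x, A' x = mulVecE A x)
    (hDf : HasFDerivAt f A' 0) (hA : IsHurwitz A)
    -- V is the analytic solution of ⟨∇V, f⟩ = −‖x‖², V(0)=0, on a neighborhood Ω of 0
    (Ω : Set (EuclideanSpace ℝ (Fin n))) (hΩ : IsOpen Ω) (h0Ω : (0 : EuclideanSpace ℝ (Fin n)) ∈ Ω)
    (V : EuclideanSpace ℝ (Fin n) → ℝ)
    (hVan : ∀ x ∈ Ω, AnalyticAt ℝ V x) (hV0 : V 0 = 0)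
    (hVeq : ∀ x ∈ Ω, ⟪gradient V x, f x⟫ = -‖x‖ ^ 2)
    (p : ℕ) (hp : 2 ≤ p) :
    ∃ rp > 0, ∀ x : EuclideanSpace ℝ (Fin n), 0 < ‖x‖ → ‖x‖ ≤ rp →
      0 < taylorPoly V p x ∧
      ⟪gradient (taylorPoly V p) x, f x⟫ < 0 ∧
      ⟪gradient (taylorPoly V p) x, f x⟫ ≤ -(1/2) * ‖x‖ ^ 2 := by
  have hVan0 := hVan 0 h0Ω
  set G := fderiv ℝ V with hGdef
  set B := fderiv ℝ G 0 with hB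
  have hG : HasFDerivAt G B 0 := hVan0.fderiv.differentiableAt.hasFDerivAt
  have hev : ∀ᶠ x in nhds (0 : EuclideanSpace ℝ (Fin n)), G x (f x) = -‖x‖ ^ 2 := by
    filter_upwards [hΩ.mem_nhds h0Ω] with x hx
    rw [← hVeq x hx, inner_gradient_left]
  have hsymm : ∀ x y, B x y = B y x := fun x y =>
    (hVan0.contDiffAt (n := ⊤)).isSymmSndFDerivAt (by simp) x y
  have hAinj : Function.Injective A' := by
    rw [injective_iff_map_eq_zero]
    intro x hx
    rw [hA'] at hx
    have : A.mulVec x.ofLp = 0 := by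
      simpa [mulVecE] using hx
    have := hurwitz_inj hA 0 le_rfl x.ofLp (by simpa using this)
    ext i
    exact congrFun this i
  have hAsurj : Function.Surjective A' :=
    (LinearMap.injective_iff_surjective (f := (A' : EuclideanSpace ℝ (Fin n) →ₗ[ℝ] _))).mp hAinj
  have hG0 : G 0 = 0 := by
    have h1 := hG.clm_apply hDf
    have h2 : HasFDerivAt (fun x : EuclideanSpace ℝ (Fin n) => -‖x‖ ^ 2) (0 : EuclideanSpace ℝ (Fin n) →L[ℝ] ℝ) 0 := by
      have := ((hasStrictFDerivAt_norm_sq (0 : EuclideanSpace ℝ (Fin n))).hasFDerivAt).fun_neg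
      simpa using this
    have h3 := h1.unique (h2.congr_of_eventuallyEq hev)
    ext x
    obtain ⟨y, rfl⟩ := hAsurj x
    have := congrArg (fun L => L y) h3
    simpa [hf0] using this
  have hBA : ∀ x, B x (A' x) = -‖x‖ ^ 2 := by
    intro x
    have h1 := second_order G B f A' hG0 hG hf0 hDf
    have h2 : (fun x => -‖x‖ ^ 2 - B x (A' x)) =o[nhds 0] (fun x => ‖x‖ ^ 2) := by
      refine h1.congr' ?_ Filter.EventuallyEq.rfl
      filter_upwards [hev] with x hx
      rw [hx]
    have := homog_zero _ (fun t x => by simp [norm_smul, mul_pow]; ring) h2 x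
    linarith
  have hpos : ∀ x, x ≠ 0 → 0 < B x x := by
    intro x hx
    have := lyap hA (fun z => B (WithLp.toLp 2 z) (WithLp.toLp 2 z))
      (fun z => 4 * ‖(WithLp.toLp 2 z : EuclideanSpace ℝ (Fin n))‖ ^ 2) (by fun_prop) (by simp)
      (fun y hy => by
        have : (WithLp.toLp 2 y : EuclideanSpace ℝ (Fin n)) ≠ 0 := by simpa using hy
        positivity)
      (fun y => by positivity) (fun y => by
        have h1 := hBA (WithLp.toLp 2 y)
        have h2 : A' (WithLp.toLp 2 y) = WithLp.toLp 2 (A.mulVec y) := by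
          rw [hA']; rfl
        have h3 := hsymm (WithLp.toLp 2 y) (WithLp.toLp 2 (A.mulVec y))
        rw [h2] at h1
        simp only [WithLp.toLp_sub, WithLp.toLp_add, map_sub, map_add,
          sub_apply, add_apply]
        linarith) x.ofLp (by simpa using hx)
    simpa using this
  -- coercivity
  obtain ⟨c, hc, hcoer⟩ : ∃ c > 0, ∀ x, c * ‖x‖ ^ 2 ≤ B x x := by
    by_cases hne : (Metric.sphere (0 : EuclideanSpace ℝ (Fin n)) 1).Nonempty
    · obtain ⟨z, hz, hmin⟩ := (isCompact_sphere (0 : EuclideanSpace ℝ (Fin n)) 1).exists_isMinOn hne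
        (f := fun x => B x x) (by fun_prop)
      refine ⟨B z z, hpos z (by rintro rfl; simp at hz), fun x => ?_⟩
      by_cases hx : x = 0
      · simp [hx]
      have hxn : ‖x‖ ≠ 0 := norm_ne_zero_iff.mpr hx
      have := hmin (a := ‖x‖⁻¹ • x) (by simp [norm_smul, hxn])
      simp at this
      have h2 : B x x = (‖x‖⁻¹ * (‖x‖⁻¹ * B x x)) * ‖x‖ ^ 2 := by field_simp
      rw [h2]
      gcongr
    · refine ⟨1, one_pos, fun x => ?_⟩
      by_cases hx : x = 0
      · simp [hx]
      exact absurd ⟨‖x‖⁻¹ • x, by simp [norm_smul, hx]⟩ hne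
  obtain ⟨m, rfl⟩ := Nat.exists_eq_add_of_le hp
  obtain ⟨R, R', K, hW, hR⟩ := taylor_decomp V m
  have hWd : ∀ x, HasFDerivAt (taylorPoly V (2 + m)) (B x + R' x) x := by
    intro x
    have h1 : HasFDerivAt (fun x => (1/2 : ℝ) * B x x + R x) (B x + R' x) x := by
      have := ((B.hasFDerivAt (x := x)).clm_apply (hasFDerivAt_id x)).const_mul (1/2 : ℝ)
      refine (this.add (hR x).1).congr_fderiv ?_
      ext y
      simp [hsymm y x]
      ring
    refine h1.congr_of_eventuallyEq (Filter.Eventually.of_forall fun y => ?_)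
    rw [hW y, hV0, ← hGdef, hG0]
    simp [hB]
  have hRzero : R' 0 = 0 := by
    have := ((hR 0).2 (by simp)).1
    simpa using this
  have hWG : HasFDerivAt (fun x => B x + R' x) B 0 := by
    have : HasFDerivAt R' (0 : EuclideanSpace ℝ (Fin n) →L[ℝ] EuclideanSpace ℝ (Fin n) →L[ℝ] ℝ) 0 := by
      rw [hasFDerivAt_iff_isLittleO_nhds_zero]
      simp only [zero_add, hRzero, sub_zero, zero_apply]
      have hO : R' =O[nhds 0] (fun x => ‖x‖ ^ 2) := by
        refine Asymptotics.IsBigO.of_bound K ?_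
        filter_upwards [Metric.closedBall_mem_nhds (0 : EuclideanSpace ℝ (Fin n)) one_pos] with x hx
        have := ((hR x).2 (by simpa using hx)).1
        simpa using this
      exact hO.trans_isLittleO (Asymptotics.isLittleO_norm_pow_id one_lt_two)
    simpa using (B.hasFDerivAt (x := 0)).fun_add this
  have ho := second_order (fun x => B x + R' x) B f A' (by simp [hRzero]) hWG hf0 hDf
  have ho2 := ho.def (c := 1/2) (by norm_num)
  obtain ⟨r, hr, hball⟩ := Metric.eventually_nhds_iff.mp ho2
  refine ⟨min (r / 2) (min 1 (c / (4 * (|K| + 1)))), by positivity, fun x hx0 hx => ?_⟩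
  simp only [le_min_iff] at hx
  obtain ⟨hxr, hx1, hxc⟩ := hx
  have hx2 : 0 < ‖x‖ ^ 2 := by positivity
  have hgrad : ⟪gradient (taylorPoly V (2 + m)) x, f x⟫ ≤ -(1/2) * ‖x‖ ^ 2 := by
    rw [inner_gradient_left, (hWd x).fderiv]
    have := hball (y := x) (by simp; linarith)
    simp only [hBA, norm_pow, Real.norm_eq_abs, abs_norm] at this
    have := (abs_le.mp this).2
    linarith
  refine ⟨?_, by linarith, hgrad⟩
  rw [hW x, hV0, ← hGdef, hG0, ← hB]
  have h1 := ((hR x).2 hx1).2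
  have h2 := (abs_le.mp h1).1
  have h3 := hcoer x
  rw [le_div_iff₀ (by positivity)] at hxc
  have h4 : K * ‖x‖ ^ 3 ≤ c / 4 * ‖x‖ ^ 2 := by
    have : K * ‖x‖ ≤ c / 4 := by nlinarith [le_abs_self K]
    calc K * ‖x‖ ^ 3 = (K * ‖x‖) * ‖x‖ ^ 2 := by ring
      _ ≤ _ := by gcongr
  simp only [zero_apply]
  nlinarith
end
end

section
/- Let S ⊂ ℝⁿ be compact and connected with 0 ∈ Int(S), and let V_p be a C¹ function and c > 0 with V_p(x) < c for x ∈ Int(S), V_p(x) = c for x ∈ ∂S, and suppose S ⊂ G_p where on G_p ∖ {0} we have V_p > 0 and ⟨∇V_p(x), f(x)⟩ < 0. Then for every x⁰ ∈ S, the solution x(t; x⁰) of ẋ = f(x) with x(0) = x⁰ is defined on [0,∞) and x(t; x⁰) ∈ Int(S) for all t > 0 (i.e., S is positively invariant). -/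
noncomputable section

open scoped RealInnerProductSpace

/-- `x` is a solution of the autonomous system `ẋ = f(x)` on `[0, ∞)`. -/
def IsSolOn {E : Type*} [NormedAddCommGroup E] [NormedSpace ℝ E]
    (f : E → E) (x : ℝ → E) : Prop :=
  ∀ t ∈ Set.Ici (0:ℝ), HasDerivWithinAt x (f (x t)) (Set.Ici 0) t

open Set Filter Topology Metric in
theorem aux_deriv_neg {φ : ℝ → ℝ} {d t : ℝ} (h : HasDerivAt φ d t) (hd : d < 0) :
    (∀ᶠ s in 𝓝[>] t, φ s < φ t) ∧ (∀ᶠ s in 𝓝[<] t, φ t < φ s) := by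
  have h1 := (hasDerivAt_iff_tendsto_slope.1 h).eventually (eventually_lt_nhds hd)
  constructor
  · have h2 : ∀ᶠ s in 𝓝[>] t, slope φ t s < 0 :=
      h1.filter_mono (nhdsWithin_mono _ (fun s hs => ne_of_gt hs))
    filter_upwards [h2, self_mem_nhdsWithin] with s hs hst
    have hst' : 0 < s - t := sub_pos.2 hst
    rw [slope_def_field, div_lt_iff₀ hst'] at hs
    linarith
  · have h2 : ∀ᶠ s in 𝓝[<] t, slope φ t s < 0 :=
      h1.filter_mono (nhdsWithin_mono _ (fun s hs => ne_of_lt hs))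
    filter_upwards [h2, self_mem_nhdsWithin] with s hs hst
    have hst' : s - t < 0 := sub_neg.2 hst
    rw [slope_def_field, div_lt_iff_of_neg hst'] at hs
    linarith

open Set Filter Topology Metric in
/-- Global existence for a bounded Lipschitz vector field. -/
theorem aux_global {E : Type*} [NormedAddCommGroup E] [NormedSpace ℝ E] [CompleteSpace E]
    (g : E → E) (K : NNReal) (hg : LipschitzWith K g) (L : NNReal) (hL : ∀ x, ‖g x‖ ≤ L)
    (x0 : E) : ∃ x : ℝ → E, x 0 = x0 ∧ ∀ t, HasDerivAt x (g (x t)) t := by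
  have hex : ∀ N : ℕ, ∃ α : ℝ → E, α 0 = x0 ∧
      ∀ t ∈ Ioo (-((N:ℝ)+1)) ((N:ℝ)+1), HasDerivAt α (g (α t)) t := by
    intro N
    have hN : (0:ℝ) ≤ N := N.cast_nonneg
    have hpl : IsPicardLindelof (fun _ => g) (tmin := -((N:ℝ)+1)) (tmax := (N:ℝ)+1)
        ⟨0, by constructor <;> linarith⟩ x0 (L * (N + 1)) 0 L K := by
      apply IsPicardLindelof.of_time_independent
      · intro x _; exact hL x
      · exact hg.lipschitzOnWith
      · simp
    obtain ⟨α, h0, h⟩ := hpl.exists_eq_forall_mem_Icc_hasDerivWithinAt₀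
    exact ⟨α, h0, fun t ht => (h t (Ioo_subset_Icc_self ht)).hasDerivAt (Icc_mem_nhds ht.1 ht.2)⟩
  choose α h0 hα using hex
  have huniq : ∀ M N : ℕ, M ≤ N → EqOn (α M) (α N) (Ioo (-((M:ℝ)+1)) ((M:ℝ)+1)) := by
    intro M N hMN
    have hM : (0:ℝ) ≤ M := M.cast_nonneg
    have hMN' : (M:ℝ) ≤ N := Nat.cast_le.2 hMN
    refine ODE_solution_unique_of_mem_Ioo (v := fun _ => g) (s := fun _ => univ) (K := K)
      (t₀ := 0) (fun t _ => hg.lipschitzOnWith) ⟨by linarith, by linarith⟩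
      (fun t ht => ⟨hα M t ht, mem_univ _⟩)
      (fun t ht => ⟨hα N t ⟨by linarith [ht.1], by linarith [ht.2]⟩, mem_univ _⟩) ?_
    rw [h0, h0]
  have hu2 : ∀ M N : ℕ, ∀ t : ℝ, |t| < M + 1 → |t| < N + 1 → α M t = α N t := by
    intro M N t hM hN
    rcases le_total M N with h | h
    · exact huniq M N h (abs_lt.1 hM)
    · exact (huniq N M h (abs_lt.1 hN)).symm
  have hfl : ∀ t : ℝ, |t| < (⌈|t|⌉₊ : ℝ) + 1 := fun t => by
    linarith [Nat.le_ceil |t|]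
  refine ⟨fun t => α ⌈|t|⌉₊ t, h0 _, fun t => ?_⟩
  refine (hα ⌈|t|⌉₊ t (abs_lt.1 (hfl t))).congr_of_eventuallyEq ?_
  have : Ioo (-((⌈|t|⌉₊:ℝ)+1)) ((⌈|t|⌉₊:ℝ)+1) ∈ 𝓝 t :=
    Ioo_mem_nhds (abs_lt.1 (hfl t)).1 (abs_lt.1 (hfl t)).2
  filter_upwards [this] with s hs
  exact hu2 _ _ s (hfl s) (abs_lt.2 hs)

open Set Filter Topology Metric in
/-- Local straightening near a point where `V` has negative directional derivative. -/
theorem aux_local {E : Type*} [NormedAddCommGroup E] [NormedSpace ℝ E]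
    (V : E → ℝ) (hV : ContDiff ℝ 1 V) (p v : E) (hp : fderiv ℝ V p v < 0) :
    ∃ s0 > 0, ∃ δ > 0, (∀ w ∈ ball p δ, ∀ s ∈ Ioc (0:ℝ) s0, V (w + s • v) < V w) ∧
      ∀ w ∈ ball p δ, V (w + s0 • v) < V p := by
  have hc : Continuous fun x => fderiv ℝ V x v :=
    (hV.continuous_fderiv one_ne_zero).clm_apply continuous_const
  have hd : Differentiable ℝ V := hV.differentiable one_ne_zero
  obtain ⟨ρ, hρ, hb⟩ := Metric.eventually_nhds_iff_ball.1
    (hc.continuousAt.eventually (eventually_lt_nhds hp))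
  set s0 := ρ / 2 / (‖v‖ + 1) with hs0
  have hvp : 0 < ‖v‖ + 1 := by positivity
  have hs0p : 0 < s0 := by positivity
  have hs0v : s0 * ‖v‖ ≤ ρ / 2 := by
    have : s0 * (‖v‖ + 1) = ρ / 2 := by rw [hs0]; field_simp
    nlinarith
  have hdec : ∀ w ∈ ball p (ρ/2), ∀ s ∈ Ioc (0:ℝ) s0, V (w + s • v) < V w := by
    intro w hw s hs
    have hder : ∀ r : ℝ, HasDerivAt (fun r : ℝ => V (w + r • v)) (fderiv ℝ V (w + r • v) v) r := by
      intro r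
      have h1 : HasDerivAt (fun r : ℝ => w + r • v) v r := by
        simpa using ((hasDerivAt_id r).smul_const v).const_add w
      exact (hd (w + r • v)).hasFDerivAt.comp_hasDerivAt r h1
    have hanti : StrictAntiOn (fun r : ℝ => V (w + r • v)) (Icc 0 s0) := by
      apply strictAntiOn_of_deriv_neg (convex_Icc _ _)
      · exact fun r _ => (hder r).continuousAt.continuousWithinAt
      · intro r hr
        rw [interior_Icc] at hr
        rw [(hder r).deriv]
        apply hb
        rw [mem_ball, dist_eq_norm] at hw ⊢
        have : w + r • v - p = (w - p) + r • v := by abel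
        rw [this]
        refine (norm_add_le _ _).trans_lt ?_
        rw [norm_smul, Real.norm_eq_abs, abs_of_pos hr.1]
        have : r * ‖v‖ ≤ s0 * ‖v‖ := by gcongr; exact hr.2.le
        linarith
    have := hanti (left_mem_Icc.2 hs0p.le) ⟨hs.1.le, hs.2⟩ hs.1
    simpa using this
  have h1 : V (p + s0 • v) < V p := hdec p (mem_ball_self (by positivity)) s0 ⟨hs0p, le_rfl⟩
  have hc2 : Continuous fun w => V (w + s0 • v) := hd.continuous.comp (by fun_prop)
  obtain ⟨δ, hδ, hb2⟩ := Metric.eventually_nhds_iff_ball.1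
    (hc2.continuousAt.eventually (eventually_lt_nhds h1))
  refine ⟨s0, hs0p, min δ (ρ/2), by positivity, ?_, ?_⟩
  · exact fun w hw => hdec w (ball_subset_ball (min_le_right _ _) hw)
  · exact fun w hw => hb2 w (ball_subset_ball (min_le_left _ _) hw)

open Set Filter Topology Metric in
/-- Near a boundary point of `S`, sublevel points belong to the interior of `S`. -/
theorem aux_boundary {E : Type*} [NormedAddCommGroup E] [NormedSpace ℝ E]
    (V : E → ℝ) (hV : ContDiff ℝ 1 V) (f : E → E) (S : Set E) (c : ℝ)
    (hS : IsClosed S) (hconn : IsConnected S) (hne : (interior S).Nonempty)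
    (hlt : ∀ x ∈ interior S, V x < c) (heq : ∀ x ∈ frontier S, V x = c)
    (hdir : ∀ x ∈ frontier S, fderiv ℝ V x (f x) < 0) :
    ∀ p ∈ frontier S, ∃ δ > 0, ∀ z ∈ ball p δ, V z < c → z ∈ interior S := by
  have hfS : ∀ z ∈ S, z ∉ interior S → z ∈ frontier S := fun z hz hz' => by
    rw [hS.frontier_eq]; exact ⟨hz, hz'⟩
  -- connected sublevel sets meeting the interior lie in the interior
  have hprop : ∀ T : Set E, IsPreconnected T → (∀ z ∈ T, V z < c) → (T ∩ interior S).Nonempty →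
      T ⊆ interior S := by
    intro T hT hTc hTn
    refine hT.subset_left_of_subset_union isOpen_interior hS.isOpen_compl ?_ ?_ hTn
    · exact disjoint_compl_right.mono_left interior_subset
    · intro z hz
      by_contra hcon
      rw [mem_union, not_or, mem_compl_iff, not_not] at hcon
      exact (hTc z hz).ne (heq z (hfS z hcon.2 hcon.1))
  have hseg : ∀ (w v : E) (s0 : ℝ), 0 < s0 → V w < c →
      (∀ s ∈ Ioc (0:ℝ) s0, V (w + s • v) < V w) →
      (w ∈ interior S ↔ w + s0 • v ∈ interior S) := by
    intro w v s0 hs0 hw hs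
    have hT : IsPreconnected ((fun s : ℝ => w + s • v) '' Icc 0 s0) :=
      isPreconnected_Icc.image _ (by fun_prop)
    have h0 : w ∈ (fun s : ℝ => w + s • v) '' Icc 0 s0 := ⟨0, ⟨le_rfl, hs0.le⟩, by simp⟩
    have h1 : w + s0 • v ∈ (fun s : ℝ => w + s • v) '' Icc 0 s0 := ⟨s0, ⟨hs0.le, le_rfl⟩, rfl⟩
    have hc : ∀ z ∈ (fun s : ℝ => w + s • v) '' Icc 0 s0, V z < c := by
      rintro _ ⟨s, hs', rfl⟩
      rcases hs'.1.eq_or_lt with h | h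
      · simpa [← h] using hw
      · exact (hs s ⟨h, hs'.2⟩).trans hw
    exact ⟨fun h => hprop _ hT hc ⟨w, h0, h⟩ h1, fun h => hprop _ hT hc ⟨_, h1, h⟩ h0⟩
  have hloc : ∀ p ∈ frontier S, ∃ δ > 0,
      ((ball p δ ∩ interior S).Nonempty → ∀ z ∈ ball p δ, V z < c → z ∈ interior S) ∧
      (∀ z ∈ ball p δ, V z = c → z ∈ closure (ball p δ ∩ {y | V y < c})) := by
    intro p hp
    obtain ⟨s0, hs0, δ, hδ, h1, h2⟩ := aux_local V hV p (f p) (hdir p hp)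
    rw [heq p hp] at h2
    refine ⟨δ, hδ, ?_, ?_⟩
    · rintro ⟨y, hy, hyS⟩ z hz hzc
      rw [hseg z (f p) s0 hs0 hzc (h1 z hz)]
      have hy' := (hseg y (f p) s0 hs0 (hlt y hyS) (h1 y hy)).1 hyS
      have hT : IsPreconnected ((fun w : E => w + s0 • f p) '' ball p δ) :=
        (convex_ball p δ).isPreconnected.image _ (by fun_prop)
      refine hprop _ hT ?_ ⟨_, ⟨y, hy, rfl⟩, hy'⟩ ⟨z, hz, rfl⟩
      rintro _ ⟨w, hw, rfl⟩
      exact h2 w hw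
    · intro z hz hzc
      have hcont : Continuous fun s : ℝ => z + s • f p := by fun_prop
      have ht : Tendsto (fun s : ℝ => z + s • f p) (𝓝[>] 0) (𝓝 z) := by
        have := hcont.tendsto 0
        simp only [zero_smul, add_zero] at this
        exact this.mono_left nhdsWithin_le_nhds
      refine mem_closure_of_tendsto ht ?_
      filter_upwards [ht.eventually (isOpen_ball.mem_nhds hz), Ioc_mem_nhdsGT hs0] with s hs hs'
      exact ⟨hs, (h1 z hz s hs').trans_eq hzc⟩
  choose! δ hδ hA hB using hloc
  have hmeet : ∀ p ∈ frontier S, p ∈ closure (interior S) →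
      (ball p (δ p) ∩ interior S).Nonempty := fun p hp hpc =>
    mem_closure_iff.1 hpc _ isOpen_ball (mem_ball_self (hδ p hp))
  have hcl : S ⊆ closure (interior S) := by
    by_contra hcon
    obtain ⟨q, hqS, hq⟩ := not_subset.1 hcon
    set U := interior S ∪ ⋃ p ∈ frontier S ∩ closure (interior S), ball p (δ p) with hU
    have hUo : IsOpen U := isOpen_interior.union (isOpen_biUnion fun _ _ => isOpen_ball)
    obtain ⟨y, hy⟩ := hne
    obtain ⟨z, hzS, hzU, hzc⟩ := hconn.isPreconnected U (closure (interior S))ᶜ hUo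
      isClosed_closure.isOpen_compl (by
        intro z hz
        by_cases hzc : z ∈ closure (interior S)
        · left
          by_cases hzi : z ∈ interior S
          · exact Or.inl hzi
          · have hzf := hfS z hz hzi
            exact Or.inr (mem_biUnion (⟨hzf, hzc⟩ : z ∈ frontier S ∩ closure (interior S))
              (mem_ball_self (hδ z hzf)))
        · exact Or.inr hzc) ⟨y, interior_subset hy, Or.inl hy⟩ ⟨q, hqS, hq⟩
    apply hzc
    rcases hzU with h | h
    · exact subset_closure h
    · obtain ⟨p, ⟨hpf, hpc⟩, hzp⟩ := mem_iUnion₂.1 h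
      by_cases hzi : z ∈ interior S
      · exact subset_closure hzi
      · refine closure_mono ?_ (hB p hpf z hzp (heq z (hfS z hzS hzi)))
        rintro y ⟨hyb, hyc⟩
        exact hA p hpf (hmeet p hpf hpc) y hyb hyc
  intro p hp
  exact ⟨δ p, hδ p hp, hA p hp (hmeet p hp (hcl (hS.frontier_subset hp)))⟩

open Set Filter Topology Metric in
/-- Compactly supported modification of `f` outside a bounded set. -/
theorem aux_cutoff {n : ℕ}
    (f : EuclideanSpace ℝ (Fin n) → EuclideanSpace ℝ (Fin n)) (hf : ContDiff ℝ 1 f)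
    (S : Set (EuclideanSpace ℝ (Fin n))) (hS : IsCompact S) :
    ∃ g : EuclideanSpace ℝ (Fin n) → EuclideanSpace ℝ (Fin n),
      (∀ x ∈ S, g x = f x) ∧ (∃ K, LipschitzWith K g) ∧ ∃ L : NNReal, ∀ x, ‖g x‖ ≤ L := by
  obtain ⟨R, hR⟩ := hS.isBounded.subset_closedBall 0
  let χ : ContDiffBump (0 : EuclideanSpace ℝ (Fin n)) :=
    ⟨max R 1, max R 1 + 1, by positivity, by linarith⟩
  have hg : ContDiff ℝ 1 (fun x => χ x • f x) := χ.contDiff.smul hf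
  have hsupp : HasCompactSupport (fun x => χ x • f x) := χ.hasCompactSupport.smul_right
  refine ⟨fun x => χ x • f x, ?_, ?_, ?_⟩
  · intro x hx
    have : χ x = 1 := χ.one_of_mem_closedBall
      (closedBall_subset_closedBall (le_max_left R 1) (hR hx))
    simp [this]
  · exact hg.lipschitzWith_of_hasCompactSupport hsupp one_ne_zero
  · obtain ⟨C, hC⟩ := hg.continuous.bounded_above_of_compact_support hsupp
    exact ⟨C.toNNReal, fun x => (hC x).trans (Real.le_coe_toNNReal C)⟩

theorem S_positively_invariant {n : ℕ}
    (f : EuclideanSpace ℝ (Fin n) → EuclideanSpace ℝ (Fin n))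
    (hf : ContDiff ℝ 1 f) (hf0 : f 0 = 0)
    (Vp : EuclideanSpace ℝ (Fin n) → ℝ) (hVp : ContDiff ℝ 1 Vp)
    -- Gp is an open set containing 0 on which Vp is a strict Lyapunov function
    (Gp : Set (EuclideanSpace ℝ (Fin n))) (hGpopen : IsOpen Gp)
    (h0Gp : (0 : EuclideanSpace ℝ (Fin n)) ∈ Gp)
    (hLyap : ∀ x ∈ Gp, x ≠ 0 → 0 < Vp x ∧ ⟪gradient Vp x, f x⟫ < 0)
    -- S is compact, connected, with 0 in its interior, Vp < c on Int S, Vp = c on ∂S, S ⊆ Gp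
    (S : Set (EuclideanSpace ℝ (Fin n))) (c : ℝ) (hc : 0 < c)
    (hScomp : IsCompact S) (hSconn : IsConnected S)
    (h0S : (0 : EuclideanSpace ℝ (Fin n)) ∈ interior S)
    (hlt : ∀ x ∈ interior S, Vp x < c)
    (heq : ∀ x ∈ frontier S, Vp x = c)
    (hSGp : S ⊆ Gp) :
    ∀ x0 ∈ S, ∃ x : ℝ → EuclideanSpace ℝ (Fin n),
      x 0 = x0 ∧ IsSolOn f x ∧ ∀ t > 0, x t ∈ interior S := by
  intro x0 hx0
  have hSc : IsClosed S := hScomp.isClosed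
  have hfr : ∀ x ∈ frontier S, fderiv ℝ Vp x (f x) < 0 := by
    intro x hx
    have hne : x ≠ 0 := by
      rintro rfl
      rw [hSc.frontier_eq] at hx
      exact hx.2 h0S
    have := (hLyap x (hSGp (hSc.frontier_subset hx)) hne).2
    rwa [inner_gradient_left] at this
  have hbd := aux_boundary Vp hVp f S c hSc hSconn ⟨0, h0S⟩ hlt heq hfr
  obtain ⟨g, hgf, ⟨K, hK⟩, L, hL⟩ := aux_cutoff f hf S hScomp
  obtain ⟨x, hx0', hx⟩ := aux_global g K hK L hL x0
  have hcont : Continuous x := continuous_iff_continuousAt.2 fun t => (hx t).continuousAt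
  have hder : ∀ t, x t ∈ frontier S → (∀ᶠ s in nhdsWithin t (Set.Ioi t), Vp (x s) < c) ∧
      (∀ᶠ s in nhdsWithin t (Set.Iio t), c < Vp (x s)) := by
    intro t ht
    have h1 : HasDerivAt (fun s => Vp (x s)) (fderiv ℝ Vp (x t) (g (x t))) t :=
      ((hVp.differentiable one_ne_zero) (x t)).hasFDerivAt.comp_hasDerivAt t (hx t)
    rw [hgf _ (hSc.frontier_subset ht)] at h1
    have h2 := aux_deriv_neg h1 (hfr _ ht)
    simpa only [heq _ ht] using h2
  have hstart : ∀ᶠ t in nhdsWithin (0:ℝ) (Set.Ioi 0), x t ∈ interior S := by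
    by_cases hi : x0 ∈ interior S
    · have h1 : ∀ᶠ t in nhds (0:ℝ), x t ∈ interior S :=
        hcont.continuousAt.eventually (isOpen_interior.mem_nhds (by rwa [hx0']))
      exact h1.filter_mono nhdsWithin_le_nhds
    · have hxf : x 0 ∈ frontier S := by
        rw [hSc.frontier_eq, hx0']; exact ⟨hx0, hi⟩
      obtain ⟨δ, hδ, hb⟩ := hbd _ hxf
      have h1 : ∀ᶠ t in nhds (0:ℝ), x t ∈ Metric.ball (x 0) δ :=
        hcont.continuousAt.eventually (Metric.ball_mem_nhds _ hδ)
      filter_upwards [(hder 0 hxf).1, h1.filter_mono nhdsWithin_le_nhds] with t h2 h3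
      exact hb _ h3 h2
  have hinv : ∀ t > 0, x t ∈ interior S := by
    by_contra hcon
    push Not at hcon
    obtain ⟨t1, ht1, hbad⟩ := hcon
    obtain ⟨ε, hε, hεs⟩ := (mem_nhdsGT_iff_exists_Ioo_subset).1 hstart
    have hε : (0:ℝ) < ε := hε
    set B : Set ℝ := {t | ε / 2 ≤ t ∧ x t ∉ interior S} with hB
    have hBc : IsClosed B :=
      (isClosed_le continuous_const continuous_id).inter
        (isOpen_interior.preimage hcont).isClosed_compl
    have hmemB : ∀ t > 0, x t ∉ interior S → t ∈ B := by
      intro t ht hb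
      refine ⟨?_, hb⟩
      by_contra hlt'
      push Not at hlt'
      exact hb (hεs ⟨ht, by linarith⟩)
    have hBb : BddBelow B := ⟨ε / 2, fun t ht => ht.1⟩
    have hmem : sInf B ∈ B := hBc.csInf_mem ⟨t1, hmemB t1 ht1 hbad⟩ hBb
    set τ := sInf B with hτ
    have hτ0 : 0 < τ := by linarith [hmem.1]
    have hbefore : ∀ᶠ t in nhdsWithin τ (Set.Iio τ), x t ∈ interior S := by
      filter_upwards [Ioo_mem_nhdsLT hτ0] with t ht
      by_contra hb
      exact absurd (csInf_le hBb (hmemB t ht.1 hb)) (not_le.2 ht.2)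
    have hτS : x τ ∈ S := by
      have hcl : x τ ∈ closure (interior S) :=
        mem_closure_of_tendsto (hcont.continuousAt.tendsto.mono_left nhdsWithin_le_nhds) hbefore
      exact hSc.closure_interior_subset hcl
    have hτf : x τ ∈ frontier S := by
      rw [hSc.frontier_eq]; exact ⟨hτS, hmem.2⟩
    obtain ⟨t, ht1, ht2⟩ := (hbefore.and (hder τ hτf).2).exists
    exact absurd (hlt _ ht1) (not_lt.2 ht2.le)
  refine ⟨x, hx0', ?_, hinv⟩
  intro t ht
  have hxS : x t ∈ S := by
    rcases (Set.mem_Ici.1 ht).eq_or_lt with h | h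
    · rw [← h, hx0']; exact hx0
    · exact interior_subset (hinv t h)
  have := hx t
  rw [hgf _ hxS] at this
  exact this.hasDerivWithinAt
end
end

section
/- Let A be Hurwitz, f(x) = Ax + g(x) with g continuous and g(x) = o(‖x‖) at 0, and suppose V : Ω → ℝ is C¹ on an open neighborhood Ω of 0 with V(0) = 0 and ⟨∇V(x), f(x)⟩ = −‖x‖² on Ω. Then V(x) > 0 for all x ∈ Ω' ∖ {0} for some neighborhood Ω' ⊆ Ω of 0, and 0 is asymptotically stable for ẋ = f(x). -/
noncomputable section

open Filter Metric Asymptotics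
open scoped RealInnerProductSpace

/-- The domain of attraction of the zero steady state. -/
def domAttr {E : Type*} [NormedAddCommGroup E] [NormedSpace ℝ E]
    (f : E → E) : Set E :=
  {x0 | ∃ x : ℝ → E, x 0 = x0 ∧ IsSolOn f x ∧ Tendsto x atTop (nhds 0)}


open Topology in
lemma aux_pow_tendsto {A : Type*} [NormedRing A] [NormedAlgebra ℂ A] [CompleteSpace A]
    (a : A) (h : spectralRadius ℂ a < 1) :
    Tendsto (fun k : ℕ => a ^ k) atTop (𝓝 0) := by
  obtain ⟨r, hr1, hr2⟩ := ENNReal.lt_iff_exists_nnreal_btwn.1 h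
  have hr2' : r < 1 := by exact_mod_cast hr2
  have h1 := (spectrum.pow_nnnorm_pow_one_div_tendsto_nhds_spectralRadius a).eventually
    (gt_mem_nhds hr1)
  rw [tendsto_zero_iff_norm_tendsto_zero]
  refine squeeze_zero' (Eventually.of_forall fun _ => norm_nonneg _) ?_
    (tendsto_pow_atTop_nhds_zero_of_lt_one r.coe_nonneg (by exact_mod_cast hr2'))
  filter_upwards [h1, eventually_gt_atTop 0] with k hk hk0
  have hk' : (0:ℝ) < k := by exact_mod_cast hk0
  have h2 : ((‖a ^ k‖₊ : ENNReal) ^ (1 / (k:ℝ))) ^ (k:ℝ) ≤ (r : ENNReal) ^ (k:ℝ) :=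
    ENNReal.rpow_le_rpow hk.le hk'.le
  rw [← ENNReal.rpow_mul, one_div, inv_mul_cancel₀ hk'.ne', ENNReal.rpow_one,
    ENNReal.rpow_natCast] at h2
  have h3 : ‖a ^ k‖₊ ≤ r ^ k := by exact_mod_cast h2
  exact_mod_cast h3

open Topology in
open scoped Matrix.Norms.Operator in
lemma aux_matrix_pow {n : ℕ} (B : Matrix (Fin n) (Fin n) ℂ)
    (h : ∀ z ∈ spectrum ℂ B, ‖z‖ < 1) (i j : Fin n) :
    Tendsto (fun k : ℕ => (B ^ k) i j) atTop (𝓝 0) := by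
  have : Nonempty (Fin n) := ⟨i⟩
  have h1 : spectralRadius ℂ B < ((1 : NNReal) : ENNReal) :=
    spectrum.spectralRadius_lt_of_forall_lt B (fun z hz => by exact_mod_cast h z hz)
  have h2 := aux_pow_tendsto B (by simpa using h1)
  have h3 : Continuous (fun M : Matrix (Fin n) (Fin n) ℂ => M i j) := by fun_prop
  have h4 := (h3.tendsto 0).comp h2
  exact h4

open Topology in
lemma aux_step {n : ℕ} (A : Matrix (Fin n) (Fin n) ℝ) (hA : IsHurwitz A) :
    ∃ h : ℝ, 0 < h ∧ ∀ z ∈ spectrum ℂ ((1 + h • A).map (algebraMap ℝ ℂ)), ‖z‖ < 1 := by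
  have hfin := Matrix.finite_spectrum (A.map (algebraMap ℝ ℂ))
  have key : ∀ᶠ h : ℝ in 𝓝[>] 0, ∀ μ ∈ spectrum ℂ (A.map (algebraMap ℝ ℂ)),
      h * ‖μ‖ ^ 2 < - 2 * μ.re := by
    rw [Filter.eventually_all_finite hfin]
    intro μ hμ
    have hc : Continuous (fun h : ℝ => h * ‖μ‖ ^ 2) := by fun_prop
    have := hc.tendsto 0
    simp only [zero_mul] at this
    exact (this.mono_left nhdsWithin_le_nhds).eventually
      (gt_mem_nhds (by have := hA μ hμ; linarith))
  obtain ⟨h, hh, hpos⟩ := (key.and self_mem_nhdsWithin).exists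
  have hpos : 0 < h := hpos
  refine ⟨h, hpos, fun z hz => ?_⟩
  have hmap : (1 + h • A).map (algebraMap ℝ ℂ)
      = (h : ℂ) • A.map (algebraMap ℝ ℂ) + algebraMap ℂ _ 1 := by
    ext i j
    by_cases hij : i = j <;> simp [Matrix.map_apply, hij, add_comm]
  rw [hmap, ← spectrum.add_singleton_eq] at hz
  obtain ⟨w, hw, o, ho, rfl⟩ := hz
  rw [Set.mem_singleton_iff] at ho
  subst ho
  have hne : (h : ℂ) ≠ 0 := by exact_mod_cast hpos.ne'
  have hw' : w / h ∈ spectrum ℂ (A.map (algebraMap ℝ ℂ)) := by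
    have := (spectrum.smul_mem_smul_iff (R := ℂ) (a := A.map (algebraMap ℝ ℂ)) (s := w / h)
      (r := Units.mk0 (h : ℂ) hne))
    rw [← this]
    simpa [Units.smul_def, mul_div_cancel₀ _ hne, mul_div_assoc'] using hw
  have h1 := hh _ hw'
  set μ := w / h with hμ
  have hwμ : w = h * μ := by rw [hμ]; field_simp
  rw [hwμ]
  have h2 : ‖(h : ℂ) * μ + 1‖ ^ 2 < 1 := by
    rw [← Complex.normSq_eq_norm_sq] at h1 ⊢
    simp only [Complex.normSq_apply] at h1 ⊢
    simp
    nlinarith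
  nlinarith [norm_nonneg ((h : ℂ) * μ + 1)]

open Topology in
lemma aux_clm {n : ℕ} (B : Matrix (Fin n) (Fin n) ℝ)
    (h : ∀ z ∈ spectrum ℂ (B.map (algebraMap ℝ ℂ)), ‖z‖ < 1) :
    Tendsto (fun k : ℕ => (Matrix.toEuclideanCLM (𝕜 := ℝ) B) ^ k) atTop (𝓝 0) := by
  have h1 : Tendsto (fun k : ℕ => B ^ k) atTop (𝓝 0) := by
    refine tendsto_pi_nhds.2 fun i => tendsto_pi_nhds.2 fun j => ?_
    have := aux_matrix_pow _ h i j
    have h2 := (Complex.continuous_re.tendsto 0).comp this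
    refine (h2.congr fun k => ?_)
    have : (B.map (algebraMap ℝ ℂ)) ^ k = (B ^ k).map (algebraMap ℝ ℂ) :=
      (map_pow (algebraMap ℝ ℂ).mapMatrix B k).symm
    simp only [Function.comp, this]
    simp
  have hc : Continuous (fun M : Matrix (Fin n) (Fin n) ℝ => Matrix.toEuclideanCLM (𝕜 := ℝ) M) :=
    LinearMap.continuous_of_finiteDimensional
      ((Matrix.toEuclideanCLM (𝕜 := ℝ) (n := Fin n)).toAlgEquiv.toLinearMap)
  have := (hc.tendsto 0).comp h1
  simpa [Function.comp_def] using this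

lemma aux_quad {n : ℕ} (A : Matrix (Fin n) (Fin n) ℝ) (hA : IsHurwitz A) :
    ∃ (Q : EuclideanSpace ℝ (Fin n) →L[ℝ] EuclideanSpace ℝ (Fin n) →L[ℝ] ℝ) (c C : ℝ),
      0 < c ∧ 0 < C ∧ (∀ x y, Q x y = Q y x) ∧ (∀ x, ‖x‖ ^ 2 ≤ Q x x) ∧
      (∀ x, Q x x ≤ C * ‖x‖ ^ 2) ∧ (∀ x y, |Q x y| ≤ C * ‖x‖ * ‖y‖) ∧
      ∀ x, Q x (mulVecE A x) ≤ - c * ‖x‖ ^ 2 := by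
  obtain ⟨h, hpos, hs⟩ := aux_step A hA
  set B := Matrix.toEuclideanCLM (𝕜 := ℝ) (1 + h • A) with hB
  have hBx : ∀ x, B x = x + h • mulVecE A x := by
    intro x
    rw [hB]
    simp [mulVecE]
    rfl
  have hlim := (tendsto_zero_iff_norm_tendsto_zero.1 (aux_clm _ hs))
  obtain ⟨K, hK, hK1⟩ := ((hlim.eventually (gt_mem_nhds (show (0:ℝ) < 1/2 by norm_num))).and
    (eventually_gt_atTop 0)).exists
  set Q : EuclideanSpace ℝ (Fin n) →L[ℝ] EuclideanSpace ℝ (Fin n) →L[ℝ] ℝ :=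
    ∑ k ∈ Finset.range K, (innerSL ℝ).bilinearComp (B ^ k) (B ^ k) with hQ
  have hQx : ∀ x y, Q x y = ∑ k ∈ Finset.range K, ⟪(B ^ k) x, (B ^ k) y⟫ := by
    intro x y
    simp [hQ]
  have hQs : ∀ x y, Q x y = Q y x := by
    intro x y
    rw [hQx, hQx]
    exact Finset.sum_congr rfl fun k _ => real_inner_comm _ _
  have hQ0 : ∀ x, 0 ≤ Q x x := by
    intro x
    rw [hQx]
    exact Finset.sum_nonneg fun k _ => real_inner_self_nonneg
  have hbd : ∀ x y, |Q x y| ≤ (‖Q‖ + 1) * ‖x‖ * ‖y‖ := by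
    intro x y
    have := Q.le_opNorm₂ x y
    rw [Real.norm_eq_abs] at this
    nlinarith [mul_nonneg (norm_nonneg x) (norm_nonneg y)]
  refine ⟨Q, 1 / (4 * h), ‖Q‖ + 1, by positivity, by positivity, hQs, ?_, ?_, hbd, ?_⟩
  · intro x
    rw [hQx]
    have := Finset.single_le_sum (f := fun k => ⟪(B ^ k) x, (B ^ k) x⟫)
      (s := Finset.range K) (fun k _ => real_inner_self_nonneg) (Finset.mem_range.2 hK1)
    simpa using this
  · intro x
    have := le_trans (le_abs_self _) (hbd x x)
    nlinarith
  · intro x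
    have h1 : Q (B x) (B x) = Q x x - ‖x‖ ^ 2 + ‖(B ^ K) x‖ ^ 2 := by
      rw [hQx, hQx]
      have e : ∀ k, ⟪(B ^ k) (B x), (B ^ k) (B x)⟫ = ⟪(B ^ (k+1)) x, (B ^ (k+1)) x⟫ := by
        intro k
        rw [pow_succ]; rfl
      simp only [e]
      have e2 := Finset.sum_range_succ (fun k => ⟪(B ^ k) x, (B ^ k) x⟫) K
      rw [Finset.sum_range_succ'] at e2
      have e3 : ⟪(B ^ 0) x, (B ^ 0) x⟫ = ‖x‖ ^ 2 := by simp
      rw [e3, real_inner_self_eq_norm_sq ((B ^ K) x)] at e2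
      linarith
    have h2 : ‖(B ^ K) x‖ ≤ 1 / 2 * ‖x‖ :=
      ((B ^ K).le_opNorm x).trans (by gcongr)
    have h3 : ‖(B ^ K) x‖ ^ 2 ≤ 1 / 4 * ‖x‖ ^ 2 := by
      nlinarith [norm_nonneg ((B ^ K) x), norm_nonneg x]
    rw [hBx] at h1
    simp only [map_add, map_smul, add_apply, smul_apply,
      smul_eq_mul] at h1
    rw [hQs (mulVecE A x) x] at h1
    have h4 : 0 ≤ h * (h * Q (mulVecE A x) (mulVecE A x)) :=
      mul_nonneg hpos.le (mul_nonneg hpos.le (hQ0 _))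
    have h5 : 4 * h * Q x (mulVecE A x) ≤ - ‖x‖ ^ 2 := by nlinarith [sq_nonneg ‖x‖]
    have : - (1 / (4 * h)) * ‖x‖ ^ 2 = (- ‖x‖ ^ 2) / (4 * h) := by ring
    rw [this, le_div_iff₀ (by positivity)]
    linarith

/-- Euler scheme with step `h`. -/
def eulerSeq {E : Type*} [NormedAddCommGroup E] [NormedSpace ℝ E] (F : E → E) (x0 : E) (h : ℝ) :
    ℕ → E
  | 0 => x0
  | (j + 1) => eulerSeq F x0 h j + h • F (eulerSeq F x0 h j)

lemma eulerSeq_est {E : Type*} [NormedAddCommGroup E] [NormedSpace ℝ E] (F : E → E) (x0 : E)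
    (h : ℝ) (hh : 0 ≤ h) (v : E) (ε : ℝ) (p q : ℕ) (hpq : p ≤ q)
    (hF : ∀ j, p ≤ j → j < q → ‖F (eulerSeq F x0 h j) - v‖ ≤ ε) :
    ‖eulerSeq F x0 h q - eulerSeq F x0 h p - (h * ((q:ℝ) - p)) • v‖ ≤ ε * (h * ((q:ℝ) - p)) := by
  induction q, hpq using Nat.le_induction with
  | base => simp
  | succ q hpq ih =>
    have h1 := ih (fun j hj hj' => hF j hj (by omega))
    have h2 := hF q hpq (by omega)
    have e : eulerSeq F x0 h (q+1) - eulerSeq F x0 h p - (h * (((q+1 : ℕ):ℝ) - p)) • v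
        = (eulerSeq F x0 h q - eulerSeq F x0 h p - (h * ((q:ℝ) - p)) • v)
          + h • (F (eulerSeq F x0 h q) - v) := by
      simp only [eulerSeq]
      push_cast
      module
    rw [e]
    refine (norm_add_le _ _).trans ?_
    rw [norm_smul, Real.norm_of_nonneg hh]
    push_cast
    nlinarith [mul_le_mul_of_nonneg_left h2 hh]

lemma eulerSeq_lip {E : Type*} [NormedAddCommGroup E] [NormedSpace ℝ E] (F : E → E) (x0 : E)
    (h : ℝ) (hh : 0 ≤ h) (M : ℝ) (hM : ∀ x, ‖F x‖ ≤ M) (p q : ℕ) (hpq : p ≤ q) :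
    ‖eulerSeq F x0 h q - eulerSeq F x0 h p‖ ≤ M * (h * ((q:ℝ) - p)) := by
  have := eulerSeq_est F x0 h hh 0 M p q hpq (fun j _ _ => by simpa using hM _)
  simpa using this

open Topology in
/-- Peano existence for bounded continuous vector fields, globally in forward time. -/
lemma aux_peano {E : Type*} [NormedAddCommGroup E] [NormedSpace ℝ E] [ProperSpace E]
    (F : E → E) (hF : Continuous F) (M : ℝ) (hM : ∀ x, ‖F x‖ ≤ M) (x0 : E) :
    ∃ x : ℝ → E, x 0 = x0 ∧ IsSolOn F x := by
  have hM0 : 0 ≤ M := (norm_nonneg _).trans (hM 0)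
  set N : ℕ → ℝ := fun k => (k:ℝ) + 1 with hN
  have hNpos : ∀ k, 0 < N k := fun k => by simp only [hN]; positivity
  have hNtop : Tendsto N atTop atTop :=
    tendsto_atTop_add_const_right _ _ tendsto_natCast_atTop_atTop
  set X : ℕ → ℝ → E := fun k t => eulerSeq F x0 (N k)⁻¹ ⌊t * N k⌋₊ with hX
  set U := hyperfilter ℕ with hU
  have hUle : (U : Filter ℕ) ≤ atTop := Nat.hyperfilter_le_atTop
  have hfl : ∀ t : ℝ, 0 ≤ t → Tendsto (fun k => (N k)⁻¹ * (⌊t * N k⌋₊ : ℝ)) U (𝓝 t) := by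
    intro t ht
    have h1 := ((tendsto_nat_floor_mul_div_atTop (R := ℝ) ht).comp hNtop).mono_left hUle
    refine h1.congr fun k => ?_
    simp only [Function.comp]
    rw [div_eq_inv_mul]
  have hex : ∀ t : ℝ, ∃ z, Tendsto (fun k => X k t) U (𝓝 z) := by
    intro t
    have hc : IsCompact (closedBall x0 (M * |t|)) := isCompact_closedBall _ _
    obtain ⟨z, _, hz⟩ := hc.ultrafilter_le_nhds (U.map (fun k => X k t)) (by
      rw [le_principal_iff]
      refine Filter.Eventually.of_forall (f := (U : Filter ℕ)) fun k => ?_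
      rw [mem_closedBall, dist_eq_norm]
      have h1 := eulerSeq_lip F x0 (N k)⁻¹ (inv_nonneg.2 (hNpos k).le) M hM 0 ⌊t * N k⌋₊
        (Nat.zero_le _)
      refine h1.trans (mul_le_mul_of_nonneg_left ?_ hM0)
      have h2 : (⌊t * N k⌋₊ : ℝ) ≤ |t| * N k := by
        refine le_trans ?_ (Nat.floor_le (mul_nonneg (abs_nonneg t) (hNpos k).le))
        exact_mod_cast Nat.floor_le_floor
          (mul_le_mul_of_nonneg_right (le_abs_self t) (hNpos k).le)
      rw [inv_mul_le_iff₀ (hNpos k)]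
      simp only [Nat.cast_zero, sub_zero]
      linarith)
    exact ⟨z, hz⟩
  choose x hx using hex
  refine ⟨x, ?_, ?_⟩
  · refine tendsto_nhds_unique (hx 0) ?_
    have : (fun k => X k 0) = fun _ => x0 := by
      funext k
      simp [hX, eulerSeq]
    rw [this]
    exact tendsto_const_nhds
  · intro t ht
    have ht : 0 ≤ t := ht
    rw [hasDerivWithinAt_iff_isLittleO, isLittleO_iff]
    intro ε hε
    obtain ⟨η, hη, hcont⟩ := Metric.continuous_iff.1 hF (x t) ε hε
    have key : ∀ a b : ℝ, 0 ≤ a → a ≤ t → t ≤ b → M * (b - a) < η / 2 →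
        ‖x b - x a - (b - a) • F (x t)‖ ≤ ε * (b - a) := by
      intro a b ha hat htb hab
      have hb : 0 ≤ b := by linarith
      have hd : Tendsto (fun k => (N k)⁻¹ * ((⌊b * N k⌋₊ : ℝ) - ⌊a * N k⌋₊)) U (𝓝 (b - a)) := by
        simpa only [mul_sub] using (hfl b hb).sub (hfl a ha)
      have hl := (((hx b).sub (hx a)).sub (hd.smul_const (F (x t)))).norm
      refine le_of_tendsto_of_tendsto hl (hd.const_mul ε) ?_
      have ev1 := (hd.const_mul M).eventually (gt_mem_nhds hab)
      have ev2 := (hx t).eventually (Metric.ball_mem_nhds _ (half_pos hη))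
      filter_upwards [ev1, ev2] with k hk1 hk2
      have hh : 0 ≤ (N k)⁻¹ := inv_nonneg.2 (hNpos k).le
      have hf1 : ⌊a * N k⌋₊ ≤ ⌊t * N k⌋₊ :=
        Nat.floor_le_floor (mul_le_mul_of_nonneg_right hat (hNpos k).le)
      have hf2 : ⌊t * N k⌋₊ ≤ ⌊b * N k⌋₊ :=
        Nat.floor_le_floor (mul_le_mul_of_nonneg_right htb (hNpos k).le)
      refine eulerSeq_est F x0 (N k)⁻¹ hh (F (x t)) ε _ _ (hf1.trans hf2) ?_
      intro j hj1 hj2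
      have hclose : ‖eulerSeq F x0 (N k)⁻¹ j - X k t‖
          ≤ M * ((N k)⁻¹ * ((⌊b * N k⌋₊ : ℝ) - ⌊a * N k⌋₊)) := by
        have c1 : (⌊a * N k⌋₊ : ℝ) ≤ j := by exact_mod_cast hj1
        have c2 : (j : ℝ) ≤ ⌊b * N k⌋₊ := by exact_mod_cast hj2.le
        have c3 : (⌊a * N k⌋₊ : ℝ) ≤ ⌊t * N k⌋₊ := by exact_mod_cast hf1
        have c4 : (⌊t * N k⌋₊ : ℝ) ≤ ⌊b * N k⌋₊ := by exact_mod_cast hf2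
        rcases le_total j ⌊t * N k⌋₊ with hjt | hjt
        · rw [norm_sub_rev]
          refine (eulerSeq_lip F x0 (N k)⁻¹ hh M hM _ _ hjt).trans ?_
          gcongr
        · refine (eulerSeq_lip F x0 (N k)⁻¹ hh M hM _ _ hjt).trans ?_
          gcongr
      rw [← dist_eq_norm]
      refine (hcont _ ?_).le
      rw [← dist_eq_norm] at hclose
      have hk2 : dist (X k t) (x t) < η / 2 := hk2
      calc dist (eulerSeq F x0 (N k)⁻¹ j) (x t) ≤ _ := dist_triangle _ (X k t) _
        _ < η / 2 + η / 2 := by linarith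
        _ = η := by ring
    have hcM : Tendsto (fun t' : ℝ => M * |t' - t|) (𝓝[Set.Ici 0] t) (𝓝 0) := by
      have : Continuous (fun t' : ℝ => M * |t' - t|) := by fun_prop
      have := this.tendsto t
      simp only [sub_self, abs_zero, mul_zero] at this
      exact this.mono_left nhdsWithin_le_nhds
    filter_upwards [hcM.eventually (gt_mem_nhds (half_pos hη)), self_mem_nhdsWithin] with t' h1 h2
    have h2 : 0 ≤ t' := h2
    rcases le_total t t' with h | h
    · rw [abs_of_nonneg (by linarith)] at h1
      rw [Real.norm_of_nonneg (by linarith)]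
      exact key t t' ht le_rfl h h1
    · rw [abs_of_nonpos (by linarith)] at h1
      rw [Real.norm_of_nonpos (by linarith)]
      have h3 := key t' t h2 h le_rfl (by linarith)
      rw [← norm_neg]
      have e : -(x t' - x t - (t' - t) • F (x t)) = x t - x t' - (t - t') • F (x t) := by module
      rw [e]
      linarith

lemma aux_decay {E : Type*} [NormedAddCommGroup E] [NormedSpace ℝ E]
    (Q : E →L[ℝ] E →L[ℝ] ℝ) (c C r s : ℝ) (hc : 0 < c) (hC : 0 < C) (hr : 0 < r) (hs : 0 < s)
    (hsr : s ≤ r ^ 2)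
    (hsymm : ∀ x y, Q x y = Q y x) (hlow : ∀ x, ‖x‖ ^ 2 ≤ Q x x)
    (hup : ∀ x, Q x x ≤ C * ‖x‖ ^ 2) (f : E → E)
    (hdec : ∀ x, ‖x‖ ≤ r → Q x (f x) ≤ - c * ‖x‖ ^ 2)
    (x : ℝ → E) (hx : IsSolOn f x) (hx0 : Q (x 0) (x 0) ≤ s) :
    ∀ t ≥ 0, ‖x t‖ ^ 2 ≤ s * Real.exp (- (c / C) * t) := by
  intro T hT
  refine (hlow _).trans ?_
  have hder : ∀ t ∈ Set.Ici (0:ℝ), HasDerivWithinAt (fun t => Q (x t) (x t))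
      (2 * Q (x t) (f (x t))) (Set.Ici 0) t := by
    intro t ht
    have h1 := Q.hasDerivWithinAt_of_bilinear (hx t ht) (hx t ht)
    rw [hsymm (f (x t)) (x t), ← two_mul] at h1
    exact h1
  have hBder : ∀ t : ℝ, HasDerivAt (fun t => s * Real.exp (- (c / C) * t))
      (s * (Real.exp (- (c / C) * t) * (- (c / C)))) t := by
    intro t
    have h1 : HasDerivAt (fun t : ℝ => - (c / C) * t) (- (c / C)) t := by
      simpa using (hasDerivAt_id t).const_mul (- (c / C))
    exact h1.exp.const_mul s
  refine image_le_of_deriv_right_lt_deriv_boundary' (a := 0) (b := T)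
    (f := fun t => Q (x t) (x t))
    (f' := fun t => 2 * Q (x t) (f (x t)))
    (B := fun t => s * Real.exp (- (c / C) * t))
    (B' := fun t => s * (Real.exp (- (c / C) * t) * (- (c / C))))
    ?_ ?_ ?_ ?_ ?_ ?_ ⟨hT, le_rfl⟩
  · exact fun t ht => ((hder t ht.1).continuousWithinAt).mono Set.Icc_subset_Ici_self
  · exact fun t ht => (hder t ht.1).mono (Set.Ici_subset_Ici.2 ht.1)
  · simpa using hx0
  · exact fun t _ => (hBder t).continuousAt.continuousWithinAt
  · exact fun t _ => (hBder t).hasDerivWithinAt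
  · intro t ht heq
    have hexp : Real.exp (- (c / C) * t) ≤ 1 := by
      rw [Real.exp_le_one_iff]
      have : 0 ≤ c / C * t := mul_nonneg (by positivity) ht.1
      linarith
    have hw : 0 < Q (x t) (x t) := by rw [heq]; positivity
    have hle : Q (x t) (x t) ≤ r ^ 2 := by rw [heq]; nlinarith
    have hxr : ‖x t‖ ≤ r := by
      have := (hlow (x t)).trans hle
      exact (sq_le_sq₀ (norm_nonneg _) hr.le).1 this
    have h1 := hdec _ hxr
    have h2 := hup (x t)
    have h3 : s * (Real.exp (- (c / C) * t) * (- (c / C))) = - (c / C) * Q (x t) (x t) := by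
      rw [heq]; ring
    rw [h3]
    have h4 : c / C * Q (x t) (x t) ≤ c * ‖x t‖ ^ 2 := by
      rw [div_mul_eq_mul_div, div_le_iff₀ hC]
      nlinarith
    have h5 : 0 < ‖x t‖ ^ 2 := by
      by_contra hcon
      have : ‖x t‖ ^ 2 = 0 := le_antisymm (not_lt.1 hcon) (sq_nonneg _)
      rw [this] at h2
      linarith
    nlinarith [mul_pos hc h5]

theorem Lyapunov_solution_positive_and_asymptotic_stability {n : ℕ}
    (A : Matrix (Fin n) (Fin n) ℝ) (hA : IsHurwitz A)
    (g f : EuclideanSpace ℝ (Fin n) → EuclideanSpace ℝ (Fin n))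
    (hg : Continuous g)
    (hgo : g =o[nhds 0] (fun x : EuclideanSpace ℝ (Fin n) => x))
    (hf : ∀ x, f x = mulVecE A x + g x)
    (Ω : Set (EuclideanSpace ℝ (Fin n))) (hΩ : IsOpen Ω)
    (h0Ω : (0 : EuclideanSpace ℝ (Fin n)) ∈ Ω)
    (V : EuclideanSpace ℝ (Fin n) → ℝ)
    (hV : ContDiffOn ℝ 1 V Ω) (hV0 : V 0 = 0)
    (heq : ∀ x ∈ Ω, ⟪gradient V x, f x⟫ = -‖x‖ ^ 2) :
    -- V is strictly positive near 0, away from 0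
    (∃ Ω' ⊆ Ω, IsOpen Ω' ∧ (0 : EuclideanSpace ℝ (Fin n)) ∈ Ω' ∧
      ∀ x ∈ Ω', x ≠ 0 → 0 < V x) ∧
    -- and the origin is asymptotically stable: Lyapunov stability …
    (∀ ε > 0, ∃ δ > 0, ∀ x : ℝ → EuclideanSpace ℝ (Fin n),
      IsSolOn f x → ‖x 0‖ < δ → ∀ t ≥ 0, ‖x t‖ < ε) ∧
    -- … plus local attraction
    (∃ δ > 0, ball (0 : EuclideanSpace ℝ (Fin n)) δ ⊆ domAttr f) := by
  obtain ⟨Q, c, C, hc, hC, hsymm, hlow, hup, hbd, hQA⟩ := aux_quad A hA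
  have hfc : Continuous f := by
    have h1 : f = fun x => Matrix.toEuclideanCLM (𝕜 := ℝ) A x + g x := by
      funext x
      rw [hf]
      rfl
    rw [h1]
    exact (ContinuousLinearMap.continuous _).add hg
  have hQc : Continuous (fun x => Q x x) := by fun_prop
  -- a good radius
  have hev : ∀ᶠ x in nhds (0 : EuclideanSpace ℝ (Fin n)),
      ‖g x‖ ≤ c / (2 * C) * ‖x‖ ∧ x ∈ Ω :=
    (hgo.bound (show 0 < c / (2 * C) by positivity)).and (hΩ.mem_nhds h0Ω)
  obtain ⟨r, hr, hball⟩ := Metric.nhds_basis_closedBall.eventually_iff.1 hev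
  have hball' : ∀ x : EuclideanSpace ℝ (Fin n), ‖x‖ ≤ r →
      ‖g x‖ ≤ c / (2 * C) * ‖x‖ ∧ x ∈ Ω := fun x hx => hball (by simpa using hx)
  have hdec : ∀ x, ‖x‖ ≤ r → Q x (f x) ≤ - (c / 2) * ‖x‖ ^ 2 := by
    intro x hx
    have h1 := (hball' x hx).1
    have h2 := (le_abs_self _).trans (hbd x (g x))
    have h3 : C * ‖x‖ * ‖g x‖ ≤ C * ‖x‖ * (c / (2 * C) * ‖x‖) := by gcongr
    have h4 : C * ‖x‖ * (c / (2 * C) * ‖x‖) = c / 2 * ‖x‖ ^ 2 := by field_simp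
    rw [hf, map_add]
    have h5 := hQA x
    linarith
  have hin : ∀ x, Q x x ≤ r ^ 2 → ‖x‖ ≤ r := fun x hx =>
    (sq_le_sq₀ (norm_nonneg _) hr.le).1 ((hlow x).trans hx)
  have hc2 : 0 < c / 2 := by positivity
  refine ⟨?_, ?_, ?_⟩
  · -- positivity
    set S : Set (EuclideanSpace ℝ (Fin n)) := {x | Q x x ≤ r ^ 2} with hS
    have hSc : IsCompact S := by
      refine (isCompact_closedBall (0 : EuclideanSpace ℝ (Fin n)) r).of_isClosed_subset
        (isClosed_le hQc continuous_const) ?_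
      intro x hx
      simpa using hin x hx
    have hSΩ : S ⊆ Ω := fun x hx => (hball' x (hin x hx)).2
    have h0S : (0 : EuclideanSpace ℝ (Fin n)) ∈ S := by
      simp only [hS, Set.mem_ofPred_eq, map_zero]
      positivity
    have hmin0 : ∀ z ∈ S, (∀ y ∈ S, V z ≤ V y) → z = 0 := by
      intro z hz hmin
      by_contra hz0
      have hzn : 0 < ‖z‖ ^ 2 := by
        have := norm_pos_iff.2 hz0
        positivity
      have hline : HasDerivAt (fun τ : ℝ => z + τ • f z) (f z) 0 := by
        simpa using ((hasDerivAt_id (0:ℝ)).smul_const (f z)).const_add z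
      have hVd : DifferentiableAt ℝ V (z + (0:ℝ) • f z) := by
        rw [zero_smul, add_zero]
        exact (hV.differentiableOn one_ne_zero).differentiableAt (hΩ.mem_nhds (hSΩ hz))
      have hV1 : HasDerivAt (fun τ : ℝ => V (z + τ • f z)) (-‖z‖ ^ 2) 0 := by
        have h1 := hVd.hasGradientAt.hasFDerivAt.comp_hasDerivAt (0:ℝ) hline
        rw [zero_smul, add_zero] at h1
        rw [← heq z (hSΩ hz)]
        exact h1
      have hW1 : HasDerivAt (fun τ : ℝ => Q (z + τ • f z) (z + τ • f z)) (2 * Q z (f z)) 0 := by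
        have h1 := Q.hasDerivWithinAt_of_bilinear (hline.hasDerivWithinAt (s := Set.univ))
          (hline.hasDerivWithinAt (s := Set.univ))
        rw [zero_smul, add_zero, hsymm (f z) z, ← two_mul] at h1
        exact hasDerivWithinAt_univ.1 h1
      have hneg : ∀ (φ : ℝ → ℝ) (d : ℝ), HasDerivAt φ d 0 → d < 0 →
          ∀ᶠ τ in nhdsWithin (0:ℝ) (Set.Ioi 0), φ τ < φ 0 := by
        intro φ d hφ hd
        have h1 := (hasDerivWithinAt_iff_tendsto_slope' (Set.self_notMem_Ioi)).1
          (hφ.hasDerivWithinAt (s := Set.Ioi 0))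
        filter_upwards [h1.eventually (gt_mem_nhds hd), self_mem_nhdsWithin] with τ h2 h3
        have h3 : 0 < τ := h3
        rw [slope_def_field, sub_zero, div_lt_iff₀ h3] at h2
        linarith
      have e1 := hneg _ _ hV1 (by linarith)
      have e2 := hneg _ _ hW1 (by have := hdec z (hin z hz); nlinarith)
      obtain ⟨τ, h1, h2⟩ := (e1.and e2).exists
      simp only [zero_smul, add_zero] at h1 h2
      have h3 := hmin (z + τ • f z) (h2.le.trans hz)
      linarith
    obtain ⟨z, hz, hzmin⟩ := hSc.exists_isMinOn ⟨0, h0S⟩ (hV.continuousOn.mono hSΩ)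
    have hzmin' : ∀ y ∈ S, V z ≤ V y := fun y hy => hzmin hy
    have hz0 := hmin0 z hz hzmin'
    rw [hz0, hV0] at hzmin'
    refine ⟨{x | Q x x < r ^ 2}, fun x hx => hSΩ (show Q x x ≤ r ^ 2 from le_of_lt hx),
      isOpen_lt hQc continuous_const, ?_, ?_⟩
    · simp only [Set.mem_ofPred_eq, map_zero]
      positivity
    · intro x hx hxne
      have hxS : x ∈ S := show Q x x ≤ r ^ 2 from le_of_lt hx
      refine lt_of_le_of_ne (hzmin' x hxS) fun hcon => hxne (hmin0 x hxS ?_)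
      rw [← hcon]
      exact hzmin'
  · -- Lyapunov stability
    intro ε hε
    set s := min (r ^ 2) (ε ^ 2 / 4) with hs
    have hspos : 0 < s := lt_min (by positivity) (by positivity)
    refine ⟨Real.sqrt (s / C), Real.sqrt_pos.2 (by positivity), fun x hx hx0 t ht => ?_⟩
    have hx0' : Q (x 0) (x 0) ≤ s := by
      have h1 := (Real.lt_sqrt (norm_nonneg _)).1 hx0
      rw [lt_div_iff₀ hC] at h1
      have := hup (x 0)
      linarith
    have h2 := aux_decay Q (c / 2) C r s hc2 hC hr hspos (min_le_left _ _) hsymm hlow hup f hdec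
      x hx hx0' t ht
    have hexp : Real.exp (- (c / 2 / C) * t) ≤ 1 := by
      rw [Real.exp_le_one_iff]
      have : 0 ≤ c / 2 / C * t := mul_nonneg (by positivity) ht
      linarith
    have h3 : s ≤ ε ^ 2 / 4 := min_le_right _ _
    have h4 : ‖x t‖ ^ 2 < ε ^ 2 := by nlinarith [sq_pos_of_pos hε]
    exact (sq_lt_sq₀ (norm_nonneg _) hε.le).1 h4
  · -- attraction
    have hspos : 0 < r ^ 2 := by positivity
    refine ⟨Real.sqrt (r ^ 2 / C), Real.sqrt_pos.2 (by positivity), fun x0 hx0 => ?_⟩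
    have hx0 : ‖x0‖ < Real.sqrt (r ^ 2 / C) := by simpa using hx0
    have hx0' : Q x0 x0 ≤ r ^ 2 := by
      have h1 := (Real.lt_sqrt (norm_nonneg _)).1 hx0
      rw [lt_div_iff₀ hC] at h1
      have := hup x0
      linarith
    -- truncated vector field
    set pr : EuclideanSpace ℝ (Fin n) → EuclideanSpace ℝ (Fin n) :=
      fun x => (r / max r ‖x‖) • x with hpr
    have hmax : ∀ x : EuclideanSpace ℝ (Fin n), 0 < max r ‖x‖ := fun x => lt_max_of_lt_left hr
    have hprc : Continuous pr :=
      (continuous_const.div (continuous_const.max continuous_norm)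
        (fun x => (hmax x).ne')).smul continuous_id
    have hprn : ∀ x, ‖pr x‖ ≤ r := by
      intro x
      simp only [hpr]
      rw [norm_smul, Real.norm_of_nonneg (div_nonneg hr.le (hmax x).le), div_mul_eq_mul_div,
        div_le_iff₀ (hmax x)]
      exact mul_le_mul_of_nonneg_left (le_max_right _ _) hr.le
    have hpre : ∀ x, ‖x‖ ≤ r → pr x = x := by
      intro x hx
      simp only [hpr]
      rw [max_eq_left hx, div_self hr.ne', one_smul]
    obtain ⟨M, hM⟩ := (isCompact_closedBall (0 : EuclideanSpace ℝ (Fin n)) r).exists_bound_of_continuousOn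
      hfc.continuousOn
    obtain ⟨x, hxi, hx⟩ := aux_peano (fun x => f (pr x)) (hfc.comp hprc) M
      (fun x => hM _ (by simpa using hprn x)) x0
    have hd := aux_decay Q (c / 2) C r (r ^ 2) hc2 hC hr hspos le_rfl hsymm hlow hup
      (fun x => f (pr x)) (fun x hx => by simp only [hpre x hx]; exact hdec x hx) x hx
      (by rw [hxi]; exact hx0')
    refine ⟨x, hxi, ?_, ?_⟩
    · intro t ht
      have h1 := hx t ht
      have h2 := hd t ht
      have hexp : Real.exp (- (c / 2 / C) * t) ≤ 1 := by
        rw [Real.exp_le_one_iff]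
        have : 0 ≤ c / 2 / C * t := mul_nonneg (by positivity) ht
        linarith
      have h3 : ‖x t‖ ≤ r := (sq_le_sq₀ (norm_nonneg _) hr.le).1 (by nlinarith)
      simp only [hpre _ h3] at h1
      exact h1
    · rw [tendsto_zero_iff_norm_tendsto_zero]
      have hlim : Tendsto (fun t : ℝ => r ^ 2 * Real.exp (- (c / 2 / C) * t)) atTop (nhds 0) := by
        have h1 : Tendsto (fun t : ℝ => - (c / 2 / C) * t) atTop atBot :=
          tendsto_id.const_mul_atTop_of_neg (by
            have : 0 < c / 2 / C := by positivity
            linarith)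
        simpa using (Real.tendsto_exp_atBot.comp h1).const_mul (r ^ 2)
      have hsq : Tendsto (fun t => ‖x t‖ ^ 2) atTop (nhds 0) :=
        squeeze_zero' (Eventually.of_forall fun _ => sq_nonneg _)
          ((eventually_ge_atTop 0).mono fun t ht => hd t ht) hlim
      have h2 := (Real.continuous_sqrt.tendsto 0).comp hsq
      simpa [Function.comp_def, Real.sqrt_sq] using h2
end
end
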